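/- arXiv:1912.03870 — 2 statements merged into one kernel-verified Lean document; each statement's English description precedes it below -/
import Mathlib

section
/- Let N, M ≥ 1 and consider the polynomial ring ℚ[x_1,…,x_N,y_1,…,y_N]. Let T be the M×M matrix with entries T_{k t} = ∑_{n=1}^{N} s_{(k,1^{n−1})}(x_1,…,x_N) · s_{(t,1^{n−1})}(y_1,…,y_N) for 1 ≤ k, t ≤ M. Then det(I_M + T) = ∑_{μ} s_μ(x_1,…,x_N) · s_μ(y_1,…,y_N), where the sum is over all partitions μ contained in the N×M rectangle, i.e. with μ_1 ≤ M and l(μ) ≤ N. (Proposition 2.14, equivalently the right-hand side of Theorem 2.12.) -/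
open MvPolynomial

/-- The complete homogeneous symmetric polynomial `h_r` in `N` variables over `ℚ`,
extended by `h_r = 0` for `r < 0` (and `h_0 = 1`). -/
noncomputable def completeHomog (N : ℕ) (r : ℤ) : MvPolynomial (Fin N) ℚ :=
  if 0 ≤ r then
    ∑ d ∈ (Fintype.piFinset fun _ : Fin N => Finset.range (r.toNat + 1)).filter
        (fun d => ∑ i, d i = r.toNat),
      ∏ i, X i ^ d i
  else 0

/-- The Schur polynomial `s_λ(x_1, …, x_N) = det(h_{λ_i - i + j})_{1 ≤ i,j ≤ k}`
for a tuple `λ` of `k` parts. -/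
noncomputable def schurPoly (N k : ℕ) (lam : Fin k → ℕ) : MvPolynomial (Fin N) ℚ :=
  Matrix.det (Matrix.of fun i j : Fin k =>
    completeHomog N ((lam i : ℤ) - (i : ℕ) + (j : ℕ)))

/-- The hook partition `(m, 1^{n-1})`, as a tuple of `n` parts. -/
def hookTuple (m n : ℕ) : Fin n → ℕ := fun i => if (i : ℕ) = 0 then m else 1

/-- Schur polynomial of the hook `(m, 1^{n-1})` in `N` variables. -/
noncomputable def hookSchur (N m n : ℕ) : MvPolynomial (Fin N) ℚ :=
  schurPoly N n (hookTuple m n)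


/-- The Jacobi–Trudi determinant `det (h_{λ_i - i + j})` of an arbitrary sequence `h`. -/
def jacobiTrudi {R : Type*} [CommRing R] (h : ℤ → R) (k : ℕ) (lam : Fin k → ℕ) : R :=
  Matrix.det (Matrix.of fun i j : Fin k => h ((lam i : ℤ) - (i : ℕ) + (j : ℕ)))

theorem map_schurPoly {N : ℕ} {S : Type*} [CommRing S] [Algebra ℚ S]
    (φ : MvPolynomial (Fin N) ℚ →ₐ[ℚ] S) (k : ℕ) (lam : Fin k → ℕ) :
    φ (schurPoly N k lam) = jacobiTrudi (fun r => φ (completeHomog N r)) k lam := by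
  rw [schurPoly, jacobiTrudi, AlgHom.map_det]
  rfl

theorem completeHomog_zero (N : ℕ) : completeHomog N 0 = 1 := by
  have : ((Fintype.piFinset fun _ : Fin N => Finset.range ((0 : ℤ).toNat + 1)).filter
      (fun d => ∑ i, d i = (0 : ℤ).toNat)) = {0} := by
    ext d
    simp [funext_iff]
  rw [completeHomog, if_pos le_rfl, this]
  simp

theorem completeHomog_of_neg (N : ℕ) {r : ℤ} (hr : r < 0) : completeHomog N r = 0 := by
  simp [completeHomog, not_le.2 hr]

section Hooks

variable {R : Type*} [CommRing R] {h : ℤ → R}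

theorem jacobiTrudi_hookTuple_one (m : ℕ) : jacobiTrudi h 1 (hookTuple m 1) = h m := by
  simp [jacobiTrudi, hookTuple]

/-- The Pieri-type recursion for hooks, by expansion along the first column. -/
theorem jacobiTrudi_hookTuple_succ (h_zero : h 0 = 1) (h_neg : ∀ r < 0, h r = 0) (m n : ℕ) :
    jacobiTrudi h (n + 2) (hookTuple m (n + 2)) =
      h m * jacobiTrudi h (n + 1) (hookTuple 1 (n + 1)) -
        jacobiTrudi h (n + 1) (hookTuple (m + 1) (n + 1)) := by
  have hrow0 : ((Matrix.of fun i j : Fin (n + 2) =>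
      h ((hookTuple m (n + 2) i : ℤ) - (i : ℕ) + (j : ℕ))).submatrix
        (Fin.succAbove 0) Fin.succ).det = jacobiTrudi h (n + 1) (hookTuple 1 (n + 1)) := by
    rw [jacobiTrudi]
    congr 1
    ext i j
    simp only [hookTuple, Matrix.submatrix_apply, Matrix.of_apply, Fin.val_succ,
      Fin.zero_succAbove]
    congr 1
    simp
    ring
  have hrow1 : ((Matrix.of fun i j : Fin (n + 2) =>
      h ((hookTuple m (n + 2) i : ℤ) - (i : ℕ) + (j : ℕ))).submatrix
        (Fin.succAbove (Fin.succ 0)) Fin.succ).det =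
        jacobiTrudi h (n + 1) (hookTuple (m + 1) (n + 1)) := by
    rw [jacobiTrudi]
    congr 1
    ext i j
    simp only [hookTuple, Matrix.submatrix_apply, Matrix.of_apply, Fin.val_succ]
    congr 1
    refine Fin.cases ?_ (fun i => ?_) i
    · rw [Fin.succ_succAbove_zero]
      simp
      ring
    · rw [Fin.succ_succAbove_succ]
      simp
      ring
  rw [jacobiTrudi, Matrix.det_succ_column_zero, Fin.sum_univ_succ, Fin.sum_univ_succ,
    Finset.sum_eq_zero, add_zero, hrow0, hrow1]
  · simp [hookTuple, h_zero, sub_eq_add_neg]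
  · intro i _
    simp only [hookTuple, Matrix.of_apply]
    rw [h_neg]
    · simp
    · simp only [Fin.val_succ, Fin.val_zero]
      rw [if_neg (by omega)]
      push_cast
      omega

theorem sum_hook_mul (h_zero : h 0 = 1) (h_neg : ∀ r < 0, h r = 0) (j m : ℕ) :
    ∑ i ∈ Finset.range (j + 1),
      (-1) ^ i * jacobiTrudi h (i + 1) (hookTuple m (i + 1)) * h ((j : ℤ) - i) = h (m + j) := by
  induction j generalizing m with
  | zero => simp [jacobiTrudi_hookTuple_one, h_zero]
  | succ j ih =>
    rw [Finset.sum_range_succ', jacobiTrudi_hookTuple_one]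
    simp only [jacobiTrudi_hookTuple_succ h_zero h_neg]
    have key : ∀ i : ℕ, (-1) ^ (i + 1) * (h m * jacobiTrudi h (i + 1) (hookTuple 1 (i + 1)) -
        jacobiTrudi h (i + 1) (hookTuple (m + 1) (i + 1))) * h (((j + 1 : ℕ) : ℤ) - (i + 1 : ℕ)) =
        (-1) ^ i * jacobiTrudi h (i + 1) (hookTuple (m + 1) (i + 1)) * h ((j : ℤ) - i) -
        h m * ((-1) ^ i * jacobiTrudi h (i + 1) (hookTuple 1 (i + 1)) * h ((j : ℤ) - i)) := by
      intro i
      rw [show (((j + 1 : ℕ) : ℤ) - (i + 1 : ℕ)) = (j : ℤ) - i by push_cast; ring]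
      ring
    rw [Finset.sum_congr rfl fun i _ => key i, Finset.sum_sub_distrib, ← Finset.mul_sum, ih, ih]
    push_cast
    rw [show ((1 : ℤ) + j) = j + 1 by ring, show (m : ℤ) + 1 + j = m + (j + 1) by ring]
    simp

end Hooks

section CauchyBinet

variable {R : Type*} [CommRing R] {ι : Type*} [LinearOrder ι] [Fintype ι]

/-- A sum over injective tuples, grouped according to their sorted rearrangement. -/
theorem sum_injective_eq_sum_strictMono {A : Type*} [AddCommMonoid A] {n : ℕ}
    (F : (Fin n → ι) → A) [DecidablePred fun f : Fin n → ι => Function.Injective f]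
    [DecidablePred fun f : Fin n → ι => StrictMono f] :
    ∑ f : Fin n → ι with Function.Injective f, F f =
      ∑ g : Fin n → ι with StrictMono g, ∑ σ : Equiv.Perm (Fin n), F (g ∘ σ) := by
  rw [Finset.sum_sigma']
  symm
  refine Finset.sum_bij (fun p _ => p.1 ∘ p.2) ?_ ?_ ?_ ?_
  · rintro ⟨g, σ⟩ hg
    simp only [Finset.mem_sigma, Finset.mem_filter, Finset.mem_univ, true_and, and_true] at hg ⊢
    exact hg.injective.comp σ.injective
  · rintro ⟨g, σ⟩ hg ⟨g', σ'⟩ hg' heq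
    simp only [Finset.mem_sigma, Finset.mem_filter, Finset.mem_univ, true_and, and_true]
      at hg hg' heq
    obtain rfl : g = g' := by
      rw [← hg.range_inj hg', ← σ.surjective.range_comp g, heq, σ'.surjective.range_comp]
    obtain rfl : σ = σ' := Equiv.ext fun i => hg.injective (congrFun heq i)
    rfl
  · intro f hf
    simp only [Finset.mem_filter, Finset.mem_univ, true_and] at hf
    refine ⟨⟨f ∘ Tuple.sort f, (Tuple.sort f)⁻¹⟩, ?_, ?_⟩
    · simp only [Finset.mem_sigma, Finset.mem_filter, Finset.mem_univ, true_and, and_true]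
      exact (Tuple.monotone_sort f).strictMono_of_injective
        (hf.comp (Tuple.sort f).injective)
    · ext i
      simp
  · intros
    rfl

/-- The **Cauchy–Binet formula**. -/
theorem det_transpose_mul_eq_sum_strictMono {n : ℕ} (A B : Matrix ι (Fin n) R)
    [DecidablePred fun f : Fin n → ι => StrictMono f] :
    (A.transpose * B).det =
      ∑ g : Fin n → ι with StrictMono g,
        (A.submatrix g id).det * (B.submatrix g id).det := by
  classical
  have hrow : A.transpose * B = fun i => ∑ s, A s i • B s := by
    ext i j
    simp [Matrix.mul_apply, Finset.sum_apply]
  have hexp : (A.transpose * B).det =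
      ∑ f : Fin n → ι, (∏ i, A (f i) i) * (B.submatrix f id).det := by
    rw [hrow]
    refine ((Matrix.detRowAlternating (R := R) (n := Fin n)).toMultilinearMap.map_sum
      (fun i s => A s i • B s)).trans (Finset.sum_congr rfl fun f _ => ?_)
    rw [MultilinearMap.map_smul_univ]
    rfl
  have hinj : ∑ f : Fin n → ι, (∏ i, A (f i) i) * (B.submatrix f id).det =
      ∑ f : Fin n → ι with Function.Injective f,
        (∏ i, A (f i) i) * (B.submatrix f id).det := by
    refine (Finset.sum_filter_of_ne fun f _ hf => ?_).symm
    by_contra hni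
    simp only [Function.Injective, not_forall] at hni
    obtain ⟨a, b, hab, hne⟩ := hni
    refine hf ?_
    rw [Matrix.det_zero_of_row_eq hne (by ext j; simp [hab]), mul_zero]
  rw [hexp, hinj, sum_injective_eq_sum_strictMono]
  refine Finset.sum_congr rfl fun g _ => ?_
  rw [Matrix.det_apply', Finset.sum_mul]
  refine Finset.sum_congr rfl fun σ _ => ?_
  have := Matrix.det_permute σ (B.submatrix g id)
  rw [Matrix.submatrix_submatrix, Function.id_comp] at this
  rw [this]
  simp only [Matrix.submatrix_apply, id, Function.comp_apply]
  ring

end CauchyBinet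

theorem StrictMono.fin_val_add_le {n m : ℕ} {f : Fin n → Fin m} (hf : StrictMono f)
    {i j : Fin n} (hij : i ≤ j) : (f i : ℕ) + j ≤ f j + i := by
  obtain ⟨d, hd⟩ := Nat.exists_eq_add_of_le (Fin.le_def.1 hij)
  induction d generalizing j with
  | zero =>
    obtain rfl : j = i := Fin.ext hd
    exact le_rfl
  | succ d ih =>
    have := @ih ⟨i + d, by omega⟩ (Fin.le_def.2 (by simp)) rfl
    have h2 : f ⟨i + d, by omega⟩ < f j := hf (Fin.lt_def.2 (by simp; omega))
    rw [Fin.lt_def] at h2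
    simp only at this
    omega

/-- Partitions in the `N × M` rectangle correspond to strictly increasing tuples
`i ↦ M - μ_i + i` in `Fin (M + N)`. -/
theorem sum_partition_eq_sum_strictMono {A : Type*} [AddCommMonoid A] (N M : ℕ)
    (F : (Fin N → ℕ) → A) [DecidablePred fun f : Fin N → Fin (M + N) => StrictMono f] :
    ∑ μ ∈ (Fintype.piFinset fun _ : Fin N => Finset.range (M + 1)).filter
        (fun μ => ∀ i j : Fin N, i ≤ j → μ j ≤ μ i), F μ =
      ∑ f : Fin N → Fin (M + N) with StrictMono f, F (fun i => M + i - f i) := by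
  symm
  refine Finset.sum_bij (fun f _ i => M + i - f i) ?_ ?_ ?_ ?_
  · intro f hf
    simp only [Finset.mem_filter, Finset.mem_univ, true_and] at hf
    simp only [Finset.mem_filter, Fintype.mem_piFinset, Finset.mem_range]
    refine ⟨fun i => ?_, fun i j hij => ?_⟩
    · have := hf.fin_val_add_le (i := ⟨0, i.pos⟩) (j := i) (Fin.le_def.2 (Nat.zero_le _))
      simp only at this
      omega
    · have := hf.fin_val_add_le hij
      omega
  · intro f hf g hg heq
    simp only [Finset.mem_filter, Finset.mem_univ, true_and] at hf hg
    have bound : ∀ f : Fin N → Fin (M + N), StrictMono f → ∀ i, (f i : ℕ) ≤ M + i := by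
      intro f hf i
      have hN := i.isLt
      have := hf.fin_val_add_le (i := i) (j := ⟨N - 1, by omega⟩) (Fin.le_def.2 (by simp; omega))
      simp only at this
      omega
    ext i
    have h1 := bound f hf i
    have h2 := bound g hg i
    have h3 := congrFun heq i
    omega
  · intro μ hμ
    simp only [Finset.mem_filter, Fintype.mem_piFinset, Finset.mem_range] at hμ
    refine ⟨fun i => ⟨M + i - μ i, by omega⟩, ?_, ?_⟩
    · simp only [Finset.mem_filter, Finset.mem_univ, true_and]
      intro i j hij
      have h1 := hμ.1 i
      have h2 := hμ.2 i j hij.le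
      rw [Fin.lt_def] at hij ⊢
      simp only
      omega
    · ext i
      have h1 := hμ.1 i
      show M + (i:ℕ) - (M + i - μ i) = μ i
      omega
  · intros
    rfl

section ToeplitzMatrices

variable {R : Type*} [CommRing R]

/-- The `M × N` matrix of hook determinants `s_{(k+1, 1^n)}`. -/
def hookMatrix (h : ℤ → R) (M N : ℕ) : Matrix (Fin M) (Fin N) R :=
  Matrix.of fun k n => jacobiTrudi h (n + 1) (hookTuple (k + 1) (n + 1))

/-- The Toeplitz matrix `h_{j - i}`. -/
def toeplitzMatrix (h : ℤ → R) (N : ℕ) : Matrix (Fin N) (Fin N) R :=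
  Matrix.of fun i j => h ((j : ℕ) - (i : ℕ))

/-- The matrix `h_{M - s + j}`, whose maximal minors are the Jacobi–Trudi determinants of the
partitions in the `N × M` rectangle. -/
def toeplitzRect (h : ℤ → R) (M N : ℕ) : Matrix (Fin (M + N)) (Fin N) R :=
  Matrix.of fun s j => h (M - (s : ℕ) + (j : ℕ))

def signDiagonal (R : Type*) [CommRing R] (N : ℕ) : Matrix (Fin N) (Fin N) R :=
  Matrix.diagonal fun i => (-1) ^ (i : ℕ)

theorem signDiagonal_mul_self (N : ℕ) : signDiagonal R N * signDiagonal R N = 1 := by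
  rw [signDiagonal, Matrix.diagonal_mul_diagonal, ← Matrix.diagonal_one]
  congr 1
  ext i
  rw [← mul_pow]
  simp

variable {h h' : ℤ → R}

theorem det_toeplitzMatrix (h_zero : h 0 = 1) (h_neg : ∀ r < 0, h r = 0) (N : ℕ) :
    (toeplitzMatrix h N).det = 1 := by
  rw [Matrix.det_of_isUpperTriangular]
  · simp [toeplitzMatrix, h_zero]
  · intro i j hij
    refine h_neg _ ?_
    have : j < i := hij
    rw [Fin.lt_def] at this
    omega

theorem hookMatrix_mul_toeplitzMatrix (h_zero : h 0 = 1) (h_neg : ∀ r < 0, h r = 0) (M N : ℕ)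
    (k : Fin M) (j : Fin N) :
    (hookMatrix h M N * (signDiagonal R N * toeplitzMatrix h N)) k j = h ((k : ℕ) + 1 + (j : ℕ)) := by
  have key := sum_hook_mul h_zero h_neg j (k + 1)
  push_cast at key
  rw [← key, Matrix.mul_apply, Finset.sum_subset (Finset.range_mono (Nat.succ_le_of_lt j.isLt)),
    ← Fin.sum_univ_eq_sum_range (fun i => (-1) ^ i *
      jacobiTrudi h (i + 1) (hookTuple (k + 1) (i + 1)) * h ((j : ℕ) - (i : ℤ))) N]
  · refine Finset.sum_congr rfl fun i _ => ?_
    simp only [signDiagonal, Matrix.diagonal_mul, hookMatrix, toeplitzMatrix, Matrix.of_apply]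
    ring
  · intro i _ hi
    rw [Finset.mem_range] at hi
    rw [h_neg _ (by omega), mul_zero]

theorem toeplitzRect_transpose_mul (h_zero : h 0 = 1) (h_neg : ∀ r < 0, h r = 0)
    (h_zero' : h' 0 = 1) (h_neg' : ∀ r < 0, h' r = 0) (M N : ℕ) :
    (toeplitzRect h M N).transpose * toeplitzRect h' M N =
      (signDiagonal R N * toeplitzMatrix h N).transpose *
        (1 + (hookMatrix h M N).transpose * hookMatrix h' M N) *
        (signDiagonal R N * toeplitzMatrix h' N) := by
  have hsplit : (toeplitzRect h M N).transpose * toeplitzRect h' M N =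
      (toeplitzMatrix h N).transpose * toeplitzMatrix h' N +
        (hookMatrix h M N * (signDiagonal R N * toeplitzMatrix h N)).transpose *
        (hookMatrix h' M N * (signDiagonal R N * toeplitzMatrix h' N)) := by
    ext i j
    rw [Matrix.add_apply, Matrix.mul_apply, Matrix.mul_apply, Matrix.mul_apply,
      Fin.sum_univ_add, add_comm]
    congr 1
    · refine Finset.sum_congr rfl fun s _ => ?_
      simp only [toeplitzRect, toeplitzMatrix, Matrix.transpose_apply, Matrix.of_apply,
        Fin.val_natAdd]
      congr 2 <;> push_cast <;> ring
    · rw [← Equiv.sum_comp Fin.revPerm]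
      refine Finset.sum_congr rfl fun s _ => ?_
      simp only [Matrix.transpose_apply, hookMatrix_mul_toeplitzMatrix h_zero h_neg,
        hookMatrix_mul_toeplitzMatrix h_zero' h_neg', toeplitzRect, Matrix.of_apply,
        Fin.revPerm_apply, Fin.val_castAdd, Fin.val_rev]
      have := s.isLt
      congr 2 <;> omega
  have hD : (toeplitzMatrix h N).transpose * toeplitzMatrix h' N =
      (signDiagonal R N * toeplitzMatrix h N).transpose *
        (signDiagonal R N * toeplitzMatrix h' N) := by
    rw [Matrix.transpose_mul, Matrix.mul_assoc, ← Matrix.mul_assoc _ _ (toeplitzMatrix h' N),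
      show (signDiagonal R N).transpose = signDiagonal R N from Matrix.diagonal_transpose _,
      signDiagonal_mul_self, Matrix.one_mul]
  rw [hsplit, hD, Matrix.transpose_mul (hookMatrix h M N)]
  simp only [Matrix.mul_add, Matrix.add_mul, Matrix.mul_one, Matrix.mul_assoc]

theorem det_one_add_hookMatrix (h_zero : h 0 = 1) (h_neg : ∀ r < 0, h r = 0)
    (h_zero' : h' 0 = 1) (h_neg' : ∀ r < 0, h' r = 0) (M N : ℕ) :
    (1 + hookMatrix h M N * (hookMatrix h' M N).transpose).det =
      ∑ μ ∈ (Fintype.piFinset fun _ : Fin N => Finset.range (M + 1)).filter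
          (fun μ => ∀ i j : Fin N, i ≤ j → μ j ≤ μ i),
        jacobiTrudi h N μ * jacobiTrudi h' N μ := by
  classical
  have hdet : ((toeplitzRect h M N).transpose * toeplitzRect h' M N).det =
      (1 + hookMatrix h M N * (hookMatrix h' M N).transpose).det := by
    have hsign : (signDiagonal R N).det * (signDiagonal R N).det = 1 := by
      rw [← Matrix.det_mul, signDiagonal_mul_self, Matrix.det_one]
    rw [toeplitzRect_transpose_mul h_zero h_neg h_zero' h_neg', Matrix.det_mul, Matrix.det_mul,
      Matrix.det_transpose, Matrix.det_mul, Matrix.det_mul, det_toeplitzMatrix h_zero h_neg,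
      det_toeplitzMatrix h_zero' h_neg', mul_one, mul_right_comm, hsign, one_mul,
      ← Matrix.det_transpose, Matrix.transpose_add, Matrix.transpose_one, Matrix.transpose_mul,
      Matrix.transpose_transpose, Matrix.det_one_add_mul_comm]
  have hminor : ∀ (h : ℤ → R) (f : Fin N → Fin (M + N)), StrictMono f →
      ((toeplitzRect h M N).submatrix f id).det = jacobiTrudi h N fun i => M + i - f i := by
    intro h f hf
    rw [jacobiTrudi]
    congr 1
    ext i j
    simp only [toeplitzRect, Matrix.submatrix_apply, Matrix.of_apply, id]
    have hN := i.isLt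
    have := hf.fin_val_add_le (i := i) (j := ⟨N - 1, by omega⟩) (Fin.le_def.2 (by simp; omega))
    simp only at this
    congr 1
    omega
  rw [← hdet, det_transpose_mul_eq_sum_strictMono, sum_partition_eq_sum_strictMono]
  refine Finset.sum_congr rfl fun f hf => ?_
  rw [Finset.mem_filter] at hf
  rw [hminor h f hf.2, hminor h' f hf.2]

end ToeplitzMatrices

/-- Proposition 2.14: for the `M × M` matrix `T` with entries
`T_{kt} = ∑_{n=1}^{N} s_{(k,1^{n-1})}(x) s_{(t,1^{n-1})}(y)`, one has
`det(I + T) = ∑_{μ ⊆ [N,M]} s_μ(x) s_μ(y)`, the sum ranging over all partitions `μ`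
contained in the `N × M` rectangle. -/
theorem det_one_add_hook_matrix (N M : ℕ) (hN : 1 ≤ N) (hM : 1 ≤ M) :
    Matrix.det
      ((1 : Matrix (Fin M) (Fin M) (MvPolynomial (Fin N ⊕ Fin N) ℚ)) +
        Matrix.of (fun k t : Fin M =>
          ∑ n ∈ Finset.Icc 1 N,
            (rename Sum.inl (hookSchur N ((k : ℕ) + 1) n)) *
              (rename Sum.inr (hookSchur N ((t : ℕ) + 1) n))))
    = ∑ μ ∈ (Fintype.piFinset fun _ : Fin N => Finset.range (M + 1)).filter
          (fun μ => ∀ i j : Fin N, i ≤ j → μ j ≤ μ i),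
        (rename Sum.inl (schurPoly N N μ)) * (rename Sum.inr (schurPoly N N μ)) := by
  simp only [hookSchur, map_schurPoly]
  rw [← det_one_add_hookMatrix (by simp [completeHomog_zero])
    (fun r hr => by simp [completeHomog_of_neg N hr]) (by simp [completeHomog_zero])
    (fun r hr => by simp [completeHomog_of_neg N hr])]
  congr 2
  refine Matrix.ext fun k t => ?_
  rw [Matrix.mul_apply]
  simp only [Matrix.of_apply, Matrix.transpose_apply, hookMatrix]
  rw [← Finset.Ico_add_one_right_eq_Icc,
    Finset.sum_Ico_eq_sum_range, Nat.add_sub_cancel, ← Fin.sum_univ_eq_sum_range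
      (fun n => jacobiTrudi (fun r => rename Sum.inl (completeHomog N r)) (1 + n)
          (hookTuple (k + 1) (1 + n)) *
        jacobiTrudi (fun r => rename Sum.inr (completeHomog N r)) (1 + n)
          (hookTuple (t + 1) (1 + n))) N]
  refine Finset.sum_congr rfl fun n _ => ?_
  rw [add_comm 1 (n : ℕ)]
end

section
/- Branching rule for Schur Q-functions (the combinatorial content of Theorem 4.4): let N ≥ 1 and let μ be a strict partition with l(μ) ≤ N. Then, as rational functions (indeed polynomials) in x_1,…,x_N, Q_μ(x_1,…,x_N) = ∑_{ν} 2^{#(μ|ν)} x_N^{|μ|−|ν|} Q_ν(x_1,…,x_{N−1}), where the sum is over all strict partitions ν with l(ν) ≤ N−1 that are interlaced by μ, i.e. μ_i ≥ ν_i ≥ μ_{i+1} for all i, and #(μ|ν) denotes the number of parts of μ that do not occur among the parts of ν. -/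
open MvPolynomial

/-- `μ : Fin N → ℕ` has the shape of a strict partition (of length `≤ N`):
its positive parts are strictly decreasing and come before the zero parts. -/
def StrictShape {N : ℕ} (μ : Fin N → ℕ) : Prop :=
  ∀ i j : Fin N, i < j → μ j = 0 ∨ μ j < μ i

/-- The length (number of nonzero parts) of `μ`. -/
noncomputable def plen {N : ℕ} (μ : Fin N → ℕ) : ℕ :=
  (Finset.univ.filter fun i => μ i ≠ 0).card

/-- Schur's Q-function `Q_μ(x_1, …, x_k)` in the first `k` of `n` variables, viewed in the
field `ℚ(x_1, …, x_n)`: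
`Q_μ = 2^{l(μ)} ∑_{w ∈ S_k/S_{k-l}} w ⋅ (x_1^{μ_1} ⋯ x_l^{μ_l} ∏_{i ≤ l < j or i < j ≤ l} (x_i+x_j)/(x_i-x_j))`,
realized as `2^{l} / (k-l)! ∑_{w ∈ S_k}` of the (S_{k-l}-invariant) summand. -/
noncomputable def schurQ (n k : ℕ) (hk : k ≤ n) (μ : Fin k → ℕ) :
    FractionRing (MvPolynomial (Fin n) ℚ) :=
  let x : Fin k → FractionRing (MvPolynomial (Fin n) ℚ) := fun i =>
    algebraMap (MvPolynomial (Fin n) ℚ) _ (X (Fin.castLE hk i))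
  (2 : FractionRing (MvPolynomial (Fin n) ℚ)) ^ plen μ *
    (((k - plen μ).factorial : FractionRing (MvPolynomial (Fin n) ℚ)))⁻¹ *
    ∑ w : Equiv.Perm (Fin k),
      (∏ i : Fin k, x (w i) ^ μ i) *
        ∏ i : Fin k, ∏ j : Fin k,
          if i < j ∧ μ i ≠ 0 then (x (w i) + x (w j)) / (x (w i) - x (w j)) else 1

/-- `|μ| = ∑ μ_i`. -/
def pwt {N : ℕ} (μ : Fin N → ℕ) : ℕ := ∑ i, μ i

/-- `#(μ|ν)`: the number of (nonzero) parts of `μ` that do not occur among the parts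
of `ν`. -/
noncomputable def newParts {n : ℕ} (μ : Fin (n + 1) → ℕ) (ν : Fin n → ℕ) : ℕ :=
  (Finset.univ.filter fun i : Fin (n + 1) => μ i ≠ 0 ∧ ∀ j : Fin n, ν j ≠ μ i).card

section

open Finset

/-- The factor `(x_i + x_j) / (x_i - x_j)`. -/
def pairFactor {K ι : Type*} [Field K] (x : ι → K) (i j : ι) : K :=
  (x i + x j) / (x i - x j)

/-- The sum of `∏ x_{e i} ^ μ_i * ∏_{i < j} (x_{e i} + x_{e j}) / (x_{e i} - x_{e j})` over the
cosets of orderings `e` of `S`, computed by choosing the variable attached to the first part of `μ`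
and recursing. Parts after the first zero part are ignored. -/
def cosetSum {K ι : Type*} [Field K] [DecidableEq ι] (x : ι → K) :
    (k : ℕ) → (Fin k → ℕ) → Finset ι → K
  | 0, _, _ => 1
  | k + 1, μ, S =>
    if μ 0 = 0 then 1 else
      ∑ a ∈ S, x a ^ μ 0 * (∏ b ∈ S.erase a, pairFactor x a b) *
        cosetSum x k (fun i => μ i.succ) (S.erase a)

section CosetSum

variable {K ι : Type*} [Field K]

theorem pairFactor_swap (x : ι → K) (i j : ι) : pairFactor x i j = -pairFactor x j i := by
  unfold pairFactor
  rw [← neg_sub (x j) (x i), div_neg, add_comm]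

variable [DecidableEq ι] {x : ι → K}

theorem cosetSum_eq_one {k : ℕ} {μ : Fin k → ℕ} (S : Finset ι) (h : ∀ i, μ i = 0) :
    cosetSum x k μ S = 1 := by
  cases k with
  | zero => rfl
  | succ k => rw [cosetSum, if_pos (h 0)]

theorem cosetSum_succ {k : ℕ} {μ : Fin (k + 1) → ℕ} (S : Finset ι) (h : μ 0 ≠ 0) :
    cosetSum x (k + 1) μ S =
      ∑ a ∈ S, x a ^ μ 0 * (∏ b ∈ S.erase a, pairFactor x a b) *
        cosetSum x k (fun i => μ i.succ) (S.erase a) := by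
  rw [cosetSum, if_neg h]

theorem cosetSum_insert {k : ℕ} {μ : Fin (k + 1) → ℕ} {S : Finset ι} {y : ι} (hy : y ∉ S)
    (h : μ 0 ≠ 0) :
    cosetSum x (k + 1) μ (insert y S) =
      x y ^ μ 0 * (∏ b ∈ S, pairFactor x y b) * cosetSum x k (fun i => μ i.succ) S +
      ∑ a ∈ S, x a ^ μ 0 * (pairFactor x a y * ∏ b ∈ S.erase a, pairFactor x a b) *
        cosetSum x k (fun i => μ i.succ) (insert y (S.erase a)) := by
  rw [cosetSum_succ _ h, sum_insert hy, erase_insert hy]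
  congr 1
  refine sum_congr rfl fun a ha => ?_
  have hya : y ≠ a := fun e => hy (e ▸ ha)
  rw [erase_insert_of_ne hya, prod_insert fun e => hy (mem_of_mem_erase e)]

theorem cosetSum_eq_zero_of_head_eq [CharZero K] {k : ℕ} {μ : Fin (k + 2) → ℕ} (S : Finset ι)
    (h : μ 0 ≠ 0) (h01 : μ 1 = μ 0) : cosetSum x (k + 2) μ S = 0 := by
  have key : cosetSum x (k + 2) μ S = ∑ a ∈ S, ∑ b ∈ S.erase a,
      x a ^ μ 0 * x b ^ μ 0 * pairFactor x a b *
        ((∏ c ∈ (S.erase a).erase b, pairFactor x a c) *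
          ∏ c ∈ (S.erase a).erase b, pairFactor x b c) *
        cosetSum x k (fun i => μ i.succ.succ) ((S.erase a).erase b) := by
    rw [cosetSum_succ _ h]
    refine sum_congr rfl fun a _ => ?_
    rw [cosetSum_succ _ (by simpa [h01] using h), mul_sum]
    refine sum_congr rfl fun b hb => ?_
    rw [← mul_prod_erase _ _ hb]
    simp only [Fin.succ_zero_eq_one, h01]
    ring
  refine self_eq_neg.mp ?_
  conv_rhs => rw [key]
  rw [key, ← sum_neg_distrib, sum_comm' (t' := S) (s' := fun a => S.erase a)]
  · refine sum_congr rfl fun a _ => ?_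
    rw [← sum_neg_distrib]
    refine sum_congr rfl fun b _ => ?_
    rw [pairFactor_swap x b a, erase_right_comm]
    ring
  · intro a b
    simp only [mem_erase]
    tauto

theorem cosetSum_eq_zero_of_not_strictShape [CharZero K] {k : ℕ} {μ : Fin k → ℕ}
    (hμ : Antitone μ) (hs : ¬ StrictShape μ) (S : Finset ι) : cosetSum x k μ S = 0 := by
  induction k generalizing S with
  | zero => exact absurd (fun i => i.elim0) hs
  | succ k ih =>
    have h0 : μ 0 ≠ 0 := fun h => hs fun i j _ =>
      Or.inl (Nat.le_zero.mp (h ▸ hμ (Fin.zero_le j)))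
    have tail_anti : Antitone fun i : Fin k => μ i.succ :=
      fun i j hij => hμ (Fin.succ_le_succ_iff.mpr hij)
    by_cases ht : StrictShape fun i : Fin k => μ i.succ
    · cases k with
      | zero => exact absurd (fun i j hij => absurd hij (by lia)) hs
      | succ k =>
        refine cosetSum_eq_zero_of_head_eq S h0 ?_
        by_contra h1
        have h1 : μ 1 < μ 0 := lt_of_le_of_ne (hμ (Fin.zero_le 1)) h1
        refine hs fun i j hij => ?_
        induction i using Fin.cases with
        | zero =>
          induction j using Fin.cases with
          | zero => exact absurd hij (lt_irrefl _)
          | succ j =>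
            exact Or.inr ((hμ (Fin.succ_le_succ_iff.mpr (Fin.zero_le j))).trans_lt h1)
        | succ i =>
          induction j using Fin.cases with
          | zero => exact absurd hij (Fin.not_lt_zero _)
          | succ j => exact ht i j (Fin.succ_lt_succ_iff.mp hij)
    · rw [cosetSum_succ _ h0]
      exact sum_eq_zero fun a _ => by rw [ih tail_anti ht, mul_zero]

open Polynomial in
/-- Partial fraction expansion of `∏ (y + x_b) / (y - x_b)`. -/
theorem prod_pairFactor_eq (hx : Function.Injective x) {S : Finset ι} {y : ι} (hy : y ∉ S) :
    ∏ b ∈ S, pairFactor x y b =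
      1 - ∑ a ∈ S, (1 + pairFactor x a y) * ∏ b ∈ S.erase a, pairFactor x a b := by
  rcases S.eq_empty_or_nonempty with rfl | hS
  · simp
  have hne : ∀ i ∈ S, x y ≠ x i := fun i hi e => hy (hx e ▸ hi)
  have hM : (∏ i ∈ S, (Polynomial.X + Polynomial.C (x i))).Monic :=
    monic_prod_of_monic _ _ fun i _ => monic_X_add_C _
  have hN : (Lagrange.nodal S x).Monic := Lagrange.nodal_monic
  have hdM : (∏ i ∈ S, (Polynomial.X + Polynomial.C (x i))).degree = (#S : WithBot ℕ) := by
    rw [degree_prod]; simp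
  have hdeg : ((∏ i ∈ S, (Polynomial.X + Polynomial.C (x i))) - Lagrange.nodal S x).degree < #S := by
    rw [← hdM]
    exact degree_sub_lt_left (by rw [hdM, Lagrange.degree_nodal]) hM.ne_zero
      (by rw [hM.leadingCoeff, hN.leadingCoeff])
  have h := congrArg (Polynomial.eval (x y)) (Lagrange.eq_interpolate hx.injOn hdeg)
  rw [Lagrange.eval_interpolate_not_at_node _ hne] at h
  have hnod : (∏ i ∈ S, (x y - x i)) ≠ 0 :=
    prod_ne_zero_iff.mpr fun i hi => sub_ne_zero.mpr (hne i hi)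
  simp only [Polynomial.eval_sub, Polynomial.eval_prod, Polynomial.eval_add,
    Polynomial.eval_X, Polynomial.eval_C, Lagrange.eval_nodal] at h
  simp only [pairFactor, prod_div_distrib]
  rw [div_eq_iff hnod, sub_mul, one_mul, eq_sub_iff_add_eq, ← eq_sub_iff_add_eq', eq_comm,
    ← neg_inj, neg_sub, h, mul_comm, ← neg_mul, ← sum_neg_distrib]
  congr 1
  refine sum_congr rfl fun a ha => ?_
  have h1 : x y - x a ≠ 0 := sub_ne_zero.mpr (hne a ha)
  have h2 : x a - x y ≠ 0 := sub_ne_zero.mpr (hne a ha).symm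
  rw [Lagrange.nodalWeight_eq_eval_nodal_erase_inv, Lagrange.eval_nodal,
    prod_eq_zero (f := fun i => x a - x i) ha (sub_self _),
    ← mul_prod_erase S (fun i => x a + x i) ha]
  have h3 : (∏ i ∈ S.erase a, (x a - x i)) ≠ 0 := prod_ne_zero_iff.mpr fun i hi =>
    sub_ne_zero.mpr fun e => (mem_erase.mp hi).1 (hx e).symm
  field_simp
  ring

end CosetSum

section Branching

/-- The multiplicity of a part `c` of `ν` lying between consecutive parts `b ≤ a` of `μ`. -/
def partMult (K : Type*) [Field K] (a b c : ℕ) : K := if b < c ∧ c < a then 2 else 1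

/-- The coefficient with which `ν` contributes to the branching of `μ` along the variable `t`. -/
def branchWeight {K : Type*} [Field K] (t : K) {n : ℕ} (μ : Fin (n + 1) → ℕ) (ν : Fin n → ℕ) : K :=
  t ^ μ (Fin.last n) *
    ∏ i : Fin n, partMult K (μ i.castSucc) (μ i.succ) (ν i) * t ^ (μ i.castSucc - ν i)

/-- The tuples (not necessarily strict) interlaced by `μ`. -/
def interlaced {n : ℕ} (μ : Fin (n + 1) → ℕ) : Finset (Fin n → ℕ) :=
  Fintype.piFinset fun i => Icc (μ i.succ) (μ i.castSucc)

variable {K ι : Type*} [Field K]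

theorem branchWeight_cons (t : K) {n : ℕ} (μ : Fin (n + 2) → ℕ) (c : ℕ) (ν : Fin n → ℕ) :
    branchWeight t μ (Fin.cons c ν : Fin (n + 1) → ℕ) =
      partMult K (μ 0) (μ 1) c * t ^ (μ 0 - c) * branchWeight t (fun i => μ i.succ) ν := by
  unfold branchWeight
  rw [Fin.prod_univ_succ]
  simp only [Fin.cons_zero, Fin.cons_succ, Fin.castSucc_zero, Fin.succ_zero_eq_one,
    Fin.succ_last, ← Fin.succ_castSucc]
  ring

theorem sum_interlaced_succ {n : ℕ} (μ : Fin (n + 2) → ℕ) (F : (Fin (n + 1) → ℕ) → K) :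
    ∑ ν ∈ interlaced μ, F ν =
      ∑ c ∈ Icc (μ 1) (μ 0), ∑ ν ∈ interlaced fun i => μ i.succ,
        F (Fin.cons c ν : Fin (n + 1) → ℕ) := by
  rw [← sum_product']
  refine (sum_equiv (Fin.consEquiv fun _ : Fin (n + 1) => ℕ) (fun p => ?_) fun p _ => rfl).symm
  simp only [interlaced, mem_product, Fintype.mem_piFinset, Fin.forall_fin_succ (n := n)]
  simp [Fin.consEquiv]

theorem sum_interlaced_of_eq_zero {n : ℕ} {μ : Fin (n + 1) → ℕ} (hμ : ∀ i, μ i = 0)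
    (t : K) (F : (Fin n → ℕ) → K) :
    ∑ ν ∈ interlaced μ, branchWeight t μ ν * F ν = F fun _ => 0 := by
  have : interlaced μ = {fun _ => 0} := by
    unfold interlaced
    simp only [hμ, Icc_self]
    exact Fintype.piFinset_singleton _
  rw [this, sum_singleton]
  simp [branchWeight, hμ, partMult]

theorem sum_partMult {t z : K} (h : z ≠ t) {a b : ℕ} (hab : b < a) :
    ∑ c ∈ Icc b a, partMult K a b c * t ^ (a - c) * z ^ c =
      (z + t) / (z - t) * (z ^ a - t ^ (a - b) * z ^ b) := by
  have hI : ∀ c ∈ Icc b a, partMult K a b c * t ^ (a - c) * z ^ c =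
      (if c < a then t ^ (a - c) * z ^ c else 0) + if b < c then t ^ (a - c) * z ^ c else 0 := by
    intro c hc
    rw [mem_Icc] at hc
    unfold partMult
    by_cases h1 : c < a
    · by_cases h2 : b < c
      · simp only [h1, h2, and_self, if_true]; ring
      · simp [h1, h2]
    · simp [h1, hab.trans_le (not_lt.mp h1)]
  have h1 : (Icc b a).filter (· < a) = Ico b a := by ext; simp; lia
  have h2 : (Icc b a).filter (b < ·) = (Ico b a).image Nat.succ := by
    ext c
    simp only [mem_filter, mem_image, mem_Icc, mem_Ico]
    exact ⟨fun h => ⟨c - 1, by lia, by lia⟩, by rintro ⟨d, hd, rfl⟩; lia⟩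
  rw [sum_congr rfl hI, sum_add_distrib, ← sum_filter, ← sum_filter, h1, h2,
    sum_image fun _ _ _ _ h => Nat.succ_injective h]
  have e1 : ∑ c ∈ Ico b a, t ^ (a - c) * z ^ c =
      t * ∑ c ∈ Ico b a, z ^ c * t ^ (a - 1 - c) := by
    rw [mul_sum]
    refine sum_congr rfl fun c hc => ?_
    rw [mem_Ico] at hc
    rw [show a - c = a - 1 - c + 1 by lia]
    ring
  have e2 : ∑ c ∈ Ico b a, t ^ (a - c.succ) * z ^ c.succ =
      z * ∑ c ∈ Ico b a, z ^ c * t ^ (a - 1 - c) := by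
    rw [mul_sum]
    refine sum_congr rfl fun c _ => ?_
    rw [show a - c.succ = a - 1 - c by lia, pow_succ z c]
    ring
  rw [e1, e2, geom_sum₂_Ico h hab.le]
  ring

theorem StrictShape.antitone {n : ℕ} {μ : Fin n → ℕ} (h : StrictShape μ) : Antitone μ := by
  intro i j hij
  rcases hij.eq_or_lt with rfl | hlt
  · exact le_rfl
  · rcases h i j hlt with h | h
    · exact h ▸ Nat.zero_le _
    · exact h.le

theorem StrictShape.tail {n : ℕ} {μ : Fin (n + 1) → ℕ} (h : StrictShape μ) :
    StrictShape fun i : Fin n => μ i.succ :=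
  fun i j hij => h i.succ j.succ (Fin.succ_lt_succ_iff.mpr hij)

variable [DecidableEq ι] {x : ι → K}

theorem sum_interlaced_cons {n : ℕ} {μ : Fin (n + 1) → ℕ} {S : Finset ι} {y : ι} {c : ℕ}
    (hc : c ≠ 0)
    (ih : ∀ a ∈ S, cosetSum x (n + 1) μ (insert y (S.erase a)) =
      ∑ ν ∈ interlaced μ, branchWeight (x y) μ ν * cosetSum x n ν (S.erase a)) :
    ∑ ν ∈ interlaced μ, branchWeight (x y) μ ν *
        cosetSum x (n + 1) (Fin.cons c ν : Fin (n + 1) → ℕ) S =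
      ∑ a ∈ S, x a ^ c * (∏ b ∈ S.erase a, pairFactor x a b) *
        cosetSum x (n + 1) μ (insert y (S.erase a)) := by
  have h : ∀ ν : Fin n → ℕ, cosetSum x (n + 1) (Fin.cons c ν : Fin (n + 1) → ℕ) S =
      ∑ a ∈ S, x a ^ c * (∏ b ∈ S.erase a, pairFactor x a b) * cosetSum x n ν (S.erase a) :=
    fun ν => by rw [cosetSum_succ _ (by simpa using hc)]; simp
  simp only [h, mul_sum]
  rw [sum_comm]
  refine sum_congr rfl fun a ha => ?_
  rw [ih a ha, mul_sum]
  exact sum_congr rfl fun ν _ => by ring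

theorem cosetSum_insert_eq_sum [CharZero K] (hx : Function.Injective x) {n : ℕ}
    {μ : Fin (n + 1) → ℕ} (hμ : StrictShape μ) {S : Finset ι} {y : ι} (hy : y ∉ S)
    (hS : #S = n) :
    cosetSum x (n + 1) μ (insert y S) =
      ∑ ν ∈ interlaced μ, branchWeight (x y) μ ν * cosetSum x n ν S := by
  induction n generalizing S with
  | zero =>
    obtain rfl := card_eq_zero.mp hS
    have : interlaced μ = {Fin.elim0} := by
      ext ν
      exact iff_of_true (Fintype.mem_piFinset.mpr fun i => i.elim0)
        (mem_singleton.mpr (Subsingleton.elim _ _))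
    rw [this, sum_singleton]
    by_cases h0 : μ 0 = 0 <;> simp [cosetSum, branchWeight, h0]
  | succ n ih =>
    by_cases h0 : μ 0 = 0
    · have hz : ∀ i, μ i = 0 := fun i => Nat.le_zero.mp (h0 ▸ hμ.antitone (Fin.zero_le i))
      rw [sum_interlaced_of_eq_zero hz (x y) fun ν => cosetSum x (n + 1) ν S,
        cosetSum_eq_one _ hz, cosetSum_eq_one _ fun _ => rfl]
    have h10 : μ 1 < μ 0 := by
      have := hμ 0 1 Fin.zero_lt_one
      lia
    have ih' : ∀ a ∈ S, cosetSum x (n + 1) (fun i => μ i.succ) (insert y (S.erase a)) =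
        ∑ ν ∈ interlaced fun i => μ i.succ,
          branchWeight (x y) (fun i => μ i.succ) ν * cosetSum x n ν (S.erase a) :=
      fun a ha => ih hμ.tail (fun h => hy (mem_of_mem_erase h)) (by
        rw [card_erase_of_mem ha, hS, Nat.add_sub_cancel])
    have hne : ∀ a ∈ S, x a ≠ x y := fun a ha e => hy (hx e ▸ ha)
    rw [cosetSum_insert hy h0, sum_interlaced_succ]
    simp only [branchWeight_cons, mul_assoc (partMult K _ _ _ * _), ← mul_sum]
    by_cases h1 : μ 1 = 0
    · have hz : ∀ i : Fin (n + 1), μ i.succ = 0 := fun i =>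
        Nat.le_zero.mp (h1 ▸ hμ.antitone (Fin.succ_le_succ_iff.mpr (Fin.zero_le i)))
      have hsum : ∀ c ∈ Icc (μ 1) (μ 0), partMult K (μ 0) (μ 1) c * x y ^ (μ 0 - c) *
          ∑ ν ∈ interlaced fun i => μ i.succ, branchWeight (x y) (fun i => μ i.succ) ν *
            cosetSum x (n + 1) (Fin.cons c ν : Fin (n + 1) → ℕ) S =
          (if c = 0 then x y ^ μ 0 *
            (1 - ∑ a ∈ S, ∏ b ∈ S.erase a, pairFactor x a b) else 0) +
          ∑ a ∈ S, partMult K (μ 0) (μ 1) c * x y ^ (μ 0 - c) * x a ^ c *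
            ∏ b ∈ S.erase a, pairFactor x a b := by
        intro c _
        by_cases hc : c = 0
        · subst hc
          rw [sum_interlaced_of_eq_zero hz (x y) fun ν =>
              cosetSum x (n + 1) (Fin.cons 0 ν : Fin (n + 1) → ℕ) S,
            cosetSum, if_pos (Fin.cons_zero _ _)]
          simp only [partMult, not_lt_zero, false_and, if_false, if_true, pow_zero, tsub_zero,
            one_mul, mul_one, ← mul_sum]
          ring
        · rw [sum_interlaced_cons hc ih', if_neg hc, zero_add, mul_sum]
          refine sum_congr rfl fun a _ => ?_
          rw [cosetSum_eq_one _ hz]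
          ring
      rw [sum_congr rfl hsum, sum_add_distrib, sum_ite_eq', if_pos (by simp [h1]), sum_comm,
        cosetSum_eq_one _ hz, prod_pairFactor_eq hx hy, mul_one, mul_sub, mul_sub, mul_one,
        sub_add, sub_add, sub_right_inj, mul_sum, mul_sum, ← sum_sub_distrib, ← sum_sub_distrib]
      refine sum_congr rfl fun a ha => ?_
      rw [← sum_mul, sum_partMult (hne a ha) h10, cosetSum_eq_one _ hz, h1]
      simp only [pairFactor, tsub_zero, pow_zero]
      ring
    · have hrep := cosetSum_insert (x := x) (μ := (Fin.cons (μ 1) fun i : Fin (n + 1) => μ i.succ :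
        Fin (n + 2) → ℕ)) hy (by simpa using h1)
      rw [cosetSum_eq_zero_of_head_eq _ (by simpa using h1) (by
        rw [← Fin.succ_zero_eq_one, Fin.cons_succ, Fin.cons_zero])] at hrep
      simp only [Fin.cons_zero, Fin.cons_succ] at hrep
      have hpow : x y ^ μ 0 = x y ^ (μ 0 - μ 1) * x y ^ μ 1 := by
        rw [← pow_add, Nat.sub_add_cancel h10.le]
      have hsum : ∀ c ∈ Icc (μ 1) (μ 0), partMult K (μ 0) (μ 1) c * x y ^ (μ 0 - c) *
          ∑ ν ∈ interlaced fun i => μ i.succ, branchWeight (x y) (fun i => μ i.succ) ν *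
            cosetSum x (n + 1) (Fin.cons c ν : Fin (n + 1) → ℕ) S =
          ∑ a ∈ S, partMult K (μ 0) (μ 1) c * x y ^ (μ 0 - c) * x a ^ c *
            ((∏ b ∈ S.erase a, pairFactor x a b) *
              cosetSum x (n + 1) (fun i => μ i.succ) (insert y (S.erase a))) := by
        intro c hc
        rw [sum_interlaced_cons (by rw [mem_Icc] at hc; lia) ih', mul_sum]
        exact sum_congr rfl fun a _ => by ring
      rw [sum_congr rfl hsum, sum_comm]
      have hstep : ∀ a ∈ S, ∑ c ∈ Icc (μ 1) (μ 0),
          partMult K (μ 0) (μ 1) c * x y ^ (μ 0 - c) * x a ^ c *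
            ((∏ b ∈ S.erase a, pairFactor x a b) *
              cosetSum x (n + 1) (fun i => μ i.succ) (insert y (S.erase a))) =
          x a ^ μ 0 * (pairFactor x a y * ∏ b ∈ S.erase a, pairFactor x a b) *
              cosetSum x (n + 1) (fun i => μ i.succ) (insert y (S.erase a)) -
          x y ^ (μ 0 - μ 1) * (x a ^ μ 1 * (pairFactor x a y * ∏ b ∈ S.erase a, pairFactor x a b) *
              cosetSum x (n + 1) (fun i => μ i.succ) (insert y (S.erase a))) := by
        intro a ha
        rw [← sum_mul, sum_partMult (hne a ha) h10]
        simp only [pairFactor]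
        ring
      rw [sum_congr rfl hstep, sum_sub_distrib, ← mul_sum, hpow]
      linear_combination -x y ^ (μ 0 - μ 1) * hrep

end Branching

section Counting

variable {n : ℕ} {μ : Fin (n + 1) → ℕ} {ν : Fin n → ℕ}

theorem StrictShape.eq_of_eq {m : ℕ} {κ : Fin m → ℕ} (h : StrictShape κ) {i j : Fin m}
    (hi : κ i ≠ 0) (hij : κ i = κ j) : i = j := by
  rcases lt_trichotomy i j with hlt | rfl | hlt
  · have := h i j hlt
    lia
  · rfl
  · have := h j i hlt
    lia

theorem newParts_add_plen (hμ : StrictShape μ) (hν : StrictShape ν)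
    (h : ∀ i : Fin n, μ i.succ ≤ ν i ∧ ν i ≤ μ i.castSucc) :
    newParts μ ν + plen ν =
      plen μ + #{i : Fin n | μ i.succ < ν i ∧ ν i < μ i.castSucc} := by
  have hP : plen μ = newParts μ ν + #{i | μ i ≠ 0 ∧ ∃ j, ν j = μ i} := by
    unfold plen newParts
    rw [← card_filter_add_card_filter_not (s := univ.filter fun i => μ i ≠ 0)
      (fun i => ∀ j, ν j ≠ μ i), filter_filter, filter_filter]
    simp only [not_forall, not_not]
  have hN : plen ν = #{i : Fin n | μ i.succ < ν i ∧ ν i < μ i.castSucc} +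
      #{j | ν j ≠ 0 ∧ ∃ i, μ i = ν j} := by
    unfold plen
    rw [← card_filter_add_card_filter_not (s := univ.filter fun i => ν i ≠ 0)
      (fun i => ∀ j, μ j ≠ ν i), filter_filter, filter_filter]
    simp only [not_forall, not_not]
    congr 2
    ext j
    simp only [mem_filter, mem_univ, true_and]
    constructor
    · rintro ⟨-, hj⟩
      exact ⟨lt_of_le_of_ne (h j).1 (hj _), lt_of_le_of_ne (h j).2 (hj _).symm⟩
    · rintro ⟨h1, h2⟩
      refine ⟨by lia, fun i => ?_⟩
      rcases le_or_gt i j.castSucc with hi | hi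
      · have := hμ.antitone hi
        lia
      · have := hμ.antitone (Fin.castSucc_lt_iff_succ_le.mp hi)
        lia
  have hE : #{i | μ i ≠ 0 ∧ ∃ j, ν j = μ i} = #{j | ν j ≠ 0 ∧ ∃ i, μ i = ν j} := by
    rw [← card_image_of_injOn (f := μ), ← card_image_of_injOn (f := ν)]
    · congr 1
      ext v
      simp only [mem_image, mem_filter, mem_univ, true_and]
      constructor
      · rintro ⟨i, ⟨hi, j, hj⟩, rfl⟩
        exact ⟨j, ⟨by lia, i, hj.symm⟩, hj⟩
      · rintro ⟨j, ⟨hj, i, hi⟩, rfl⟩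
        exact ⟨i, ⟨by lia, j, hi.symm⟩, hi⟩
    · intro i hi j _ hij
      simp only [coe_filter, mem_univ, true_and, Set.mem_ofPred_eq] at hi
      exact hν.eq_of_eq hi.1 hij
    · intro i hi j _ hij
      simp only [coe_filter, mem_univ, true_and, Set.mem_ofPred_eq] at hi
      exact hμ.eq_of_eq hi.1 hij
  lia

theorem branchWeight_eq {K : Type*} [Field K] (t : K) (h : ∀ i : Fin n, ν i ≤ μ i.castSucc) :
    branchWeight t μ ν =
      2 ^ #{i : Fin n | μ i.succ < ν i ∧ ν i < μ i.castSucc} * t ^ (pwt μ - pwt ν) := by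
  have hw : pwt μ - pwt ν = μ (Fin.last n) + ∑ i : Fin n, (μ i.castSucc - ν i) := by
    have : ∑ i : Fin n, (μ i.castSucc - ν i) + ∑ i, ν i = ∑ i : Fin n, μ i.castSucc := by
      rw [← sum_add_distrib]
      exact sum_congr rfl fun i _ => Nat.sub_add_cancel (h i)
    unfold pwt
    rw [Fin.sum_univ_castSucc]
    lia
  unfold branchWeight partMult
  rw [hw, prod_mul_distrib, prod_pow_eq_pow_sum, pow_add, prod_ite, prod_const, prod_const_one]
  ring

end Counting

section SumOverOrderings

variable {K ι : Type*} [Field K] [DecidableEq ι]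

theorem sum_injective_succ [Fintype ι] {M : Type*} [AddCommMonoid M] {k : ℕ} (S : Finset ι)
    (G : (Fin (k + 1) → ι) → M) :
    ∑ e : Fin (k + 1) → ι with Function.Injective e ∧ ∀ i, e i ∈ S, G e =
      ∑ a ∈ S, ∑ e : Fin k → ι with Function.Injective e ∧ ∀ i, e i ∈ S.erase a,
        G (Fin.cons a e : Fin (k + 1) → ι) := by
  rw [sum_sigma']
  symm
  refine sum_bij' (fun p _ => (Fin.cons p.1 p.2 : Fin (k + 1) → ι))
    (fun e _ => ⟨e 0, fun i => e i.succ⟩) ?_ ?_ ?_ ?_ ?_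
  · rintro ⟨a, e⟩ h
    simp only [mem_sigma, mem_filter, mem_univ, true_and, mem_erase] at h
    simp only [mem_filter, mem_univ, true_and, Fin.cons_injective_iff, Fin.forall_fin_succ,
      Fin.cons_zero, Fin.cons_succ, Set.mem_range, not_exists]
    exact ⟨⟨fun i => (h.2.2 i).1, h.2.1⟩, h.1, fun i => (h.2.2 i).2⟩
  · intro e h
    simp only [mem_filter, mem_univ, true_and] at h
    simp only [mem_sigma, mem_filter, mem_univ, true_and, mem_erase]
    exact ⟨h.2 0, h.1.comp (Fin.succ_injective k),
      fun i => ⟨fun he => Fin.succ_ne_zero i (h.1 he), h.2 _⟩⟩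
  · rintro ⟨a, e⟩ _
    simp
  · intro e _
    exact Fin.cons_self_tail e
  · intros
    rfl

theorem sum_injective_eq_factorial_mul_cosetSum [Fintype ι] (x : ι → K) {k : ℕ} {μ : Fin k → ℕ}
    (hμ : StrictShape μ) {S : Finset ι} (hS : #S = k) :
    ∑ e : Fin k → ι with Function.Injective e ∧ ∀ i, e i ∈ S,
      (∏ i : Fin k, x (e i) ^ μ i) *
        ∏ i : Fin k, ∏ j : Fin k, (if i < j ∧ μ i ≠ 0 then
          (x (e i) + x (e j)) / (x (e i) - x (e j)) else 1) =
      ((k - plen μ).factorial : K) * cosetSum x k μ S := by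
  induction k generalizing S with
  | zero =>
    simp [cosetSum, Function.injective_of_subsingleton]
  | succ k ih =>
    have hlen : plen μ = (if μ 0 ≠ 0 then 1 else 0) + plen fun i : Fin k => μ i.succ := by
      unfold plen
      rw [card_filter, Fin.sum_univ_succ, ← card_filter]
    have hle : plen (fun i : Fin k => μ i.succ) ≤ k :=
      (card_filter_le _ _).trans (by simp)
    rw [sum_injective_succ]
    by_cases h0 : μ 0 = 0
    · have hz : ∀ i, μ i = 0 := fun i => Nat.le_zero.mp (h0 ▸ hμ.antitone (Fin.zero_le i))
      have hp : plen (fun i : Fin k => μ i.succ) = 0 := by simp [plen, hz]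
      have ih0 : ∀ a ∈ S, ((#{e : Fin k → ι | Function.Injective e ∧ ∀ i, e i ∈ S.erase a} : ℕ) : K)
          = (k.factorial : K) := fun a ha => by
        have := ih hμ.tail (S := S.erase a) (by rw [card_erase_of_mem ha, hS, Nat.add_sub_cancel])
        rw [hp, cosetSum_eq_one _ fun i => hz _] at this
        simpa [hz] using this
      simp only [hz, pow_zero, prod_const_one, ne_eq, not_true_eq_false, and_false, if_false,
        mul_one, sum_const, nsmul_eq_mul]
      rw [sum_congr rfl ih0, sum_const, hS, cosetSum_eq_one _ hz, hlen, hp]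
      simp [h0, Nat.factorial_succ]
    · rw [cosetSum_succ _ h0, mul_sum]
      refine sum_congr rfl fun a ha => ?_
      have hc : #(S.erase a) = k := by rw [card_erase_of_mem ha, hS, Nat.add_sub_cancel]
      have hk : k + 1 - plen μ = k - plen fun i : Fin k => μ i.succ := by
        rw [hlen, if_pos h0]; lia
      rw [hk, mul_left_comm, ← ih hμ.tail hc, mul_sum]
      refine sum_congr rfl fun e he => ?_
      simp only [mem_filter, mem_univ, true_and] at he
      have himg : univ.image e = S.erase a :=
        eq_of_subset_of_card_le (image_subset_iff.mpr fun i _ => he.2 i) (by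
          rw [hc, card_image_of_injective _ he.1, card_univ, Fintype.card_fin])
      have hprod : ∏ b ∈ S.erase a, pairFactor x a b = ∏ j : Fin k, pairFactor x a (e j) := by
        rw [← himg, prod_image he.1.injOn]
      rw [hprod, Fin.prod_univ_succ, Fin.prod_univ_succ]
      simp only [Fin.prod_univ_succ (n := k), Fin.cons_zero, Fin.cons_succ, Fin.succ_lt_succ_iff,
        Fin.succ_pos, Fin.not_lt_zero, lt_self_iff_false, false_and, if_false, true_and,
        ne_eq, h0, not_false_eq_true, if_true, one_mul, pairFactor]
      ring

theorem sum_perm_eq_sum_injective [Fintype ι] {M : Type*} [AddCommMonoid M] {k : ℕ} (σ : Fin k ↪ ι)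
    (G : (Fin k → ι) → M) :
    ∑ w : Equiv.Perm (Fin k), G (fun i => σ (w i)) =
      ∑ e : Fin k → ι with Function.Injective e ∧ ∀ i, e i ∈ univ.map σ, G e := by
  refine sum_bij (fun w _ i => σ (w i)) ?_ ?_ ?_ ?_
  · intro w _
    simp [Function.Injective]
  · intro w _ w' _ h
    ext i
    rw [σ.injective (congrFun h i)]
  · intro e he
    simp only [mem_filter, mem_univ, true_and, mem_map] at he
    choose f hf using he.2
    have hinj : Function.Injective f := fun i j hij => he.1 (by rw [← hf, ← hf, hij])
    exact ⟨Equiv.ofBijective f (Finite.injective_iff_bijective.mp hinj), mem_univ _,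
      funext hf⟩
  · intros
    rfl

theorem schurQ_eq_cosetSum {n k : ℕ} (hk : k ≤ n) {μ : Fin k → ℕ} (hμ : StrictShape μ) :
    schurQ n k hk μ = 2 ^ plen μ *
      cosetSum (fun i => algebraMap (MvPolynomial (Fin n) ℚ)
        (FractionRing (MvPolynomial (Fin n) ℚ)) (X i)) k μ
        (univ.map (Fin.castLEEmb hk)) := by
  have hfac : ((k - plen μ).factorial : FractionRing (MvPolynomial (Fin n) ℚ)) ≠ 0 :=
    Nat.cast_ne_zero.mpr (Nat.factorial_ne_zero _)
  have h := sum_injective_eq_factorial_mul_cosetSum (fun i => algebraMap (MvPolynomial (Fin n) ℚ)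
    (FractionRing (MvPolynomial (Fin n) ℚ)) (X i)) hμ (S := univ.map (Fin.castLEEmb hk)) (by simp)
  rw [← sum_perm_eq_sum_injective (Fin.castLEEmb hk)] at h
  unfold schurQ
  simp only [Fin.castLEEmb_apply] at h ⊢
  rw [h, mul_assoc, inv_mul_cancel_left₀ hfac]

end SumOverOrderings

end

/-- Branching rule for Schur Q-functions (Theorem 4.4), with `N = n + 1 ≥ 1`:
for a strict partition `μ` of length `≤ N`,
`Q_μ(x_1,…,x_N) = ∑_{ν ≺ μ} 2^{#(μ|ν)} x_N^{|μ|-|ν|} Q_ν(x_1,…,x_{N-1})`,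
the sum over strict partitions `ν` with `l(ν) ≤ N - 1` interlaced by `μ`,
i.e. `μ_i ≥ ν_i ≥ μ_{i+1}` for all `i`. -/
theorem schurQ_branching (n : ℕ) (μ : Fin (n + 1) → ℕ) (hμ : StrictShape μ) :
    schurQ (n + 1) (n + 1) le_rfl μ =
      ∑ᶠ ν : {ν : Fin n → ℕ //
          StrictShape ν ∧ ∀ i : Fin n, μ i.succ ≤ ν i ∧ ν i ≤ μ i.castSucc},
        (2 : FractionRing (MvPolynomial (Fin (n + 1)) ℚ)) ^ newParts μ ν.1 *
          (algebraMap (MvPolynomial (Fin (n + 1)) ℚ)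
              (FractionRing (MvPolynomial (Fin (n + 1)) ℚ)) (X (Fin.last n))) ^
            (pwt μ - pwt ν.1) *
          schurQ (n + 1) n (Nat.le_succ n) ν.1 := by
  have hx : Function.Injective fun i : Fin (n + 1) => algebraMap (MvPolynomial (Fin (n + 1)) ℚ)
      (FractionRing (MvPolynomial (Fin (n + 1)) ℚ)) (X i) :=
    (IsFractionRing.injective _ _).comp (MvPolynomial.X_injective)
  have hlast : Fin.last n ∉ Finset.univ.map (Fin.castLEEmb (Nat.le_succ n)) := by
    simp only [Finset.mem_map, Finset.mem_univ, true_and, not_exists]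
    exact fun i => (Fin.castSucc_lt_last i).ne
  have hins : Finset.univ.map (Fin.castLEEmb (le_refl (n + 1))) =
      insert (Fin.last n) (Finset.univ.map (Fin.castLEEmb (Nat.le_succ n))) := by
    ext i
    induction i using Fin.lastCases with
    | last => simp
    | cast i => simp [Fin.ext_iff]
  rw [finsum_subtype_eq_finsum_cond (fun ν : Fin n → ℕ => StrictShape ν ∧
      ∀ i : Fin n, μ i.succ ≤ ν i ∧ ν i ≤ μ i.castSucc) (f := fun ν =>
        (2 : FractionRing (MvPolynomial (Fin (n + 1)) ℚ)) ^ newParts μ ν *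
          (algebraMap (MvPolynomial (Fin (n + 1)) ℚ)
              (FractionRing (MvPolynomial (Fin (n + 1)) ℚ)) (X (Fin.last n))) ^
            (pwt μ - pwt ν) *
          schurQ (n + 1) n (Nat.le_succ n) ν)]
  classical
  rw [finsum_cond_eq_sum_of_cond_iff (t := (interlaced μ).filter StrictShape) _ (by
    simp [interlaced, and_comm]),
    schurQ_eq_cosetSum le_rfl hμ, hins, cosetSum_insert_eq_sum hx hμ hlast (by simp),
    Finset.mul_sum, Finset.sum_filter]
  refine Finset.sum_congr rfl fun ν hν => ?_
  simp only [interlaced, Fintype.mem_piFinset, Finset.mem_Icc] at hν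
  split_ifs with hs
  · rw [schurQ_eq_cosetSum _ hs, branchWeight_eq _ fun i => (hν i).2]
    have hpow := congrArg (fun m => (2 : FractionRing (MvPolynomial (Fin (n + 1)) ℚ)) ^ m)
      (newParts_add_plen hμ hs hν)
    simp only [pow_add] at hpow
    rw [← mul_assoc, ← mul_assoc, ← hpow]
    ring
  · have hanti : Antitone ν := by
      intro i j hij
      rcases hij.eq_or_lt with rfl | hlt
      · exact le_rfl
      · exact ((hν j).2.trans (hμ.antitone (show i.succ ≤ j.castSucc from hlt))).trans (hν i).1
    rw [cosetSum_eq_zero_of_not_strictShape hanti hs, mul_zero, mul_zero]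
end
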